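/- For every v ∈ C²(cl(B₁); ℝ) and every r ∈ (0,1], ∫_{∂B_r} |D²v(x)·x̂⊥| dH¹(x) ≥ ( 4π | ∫_{B_r} det D²v dL² | )^{1/2}, where D²v(x)·x̂⊥ denotes the matrix–vector product of the Hessian of v at x with the unit tangent x̂⊥ = (−x₂,x₁)/|x|. -/

import Mathlib

open MeasureTheory Metric Real Filter Matrix
open scoped ENNReal Topology

noncomputable section

/-- The plane `ℝ²` with the Euclidean norm. -/
abbrev E2 : Type := EuclideanSpace ℝ (Fin 2)
/-- The space `ℝ³` with the Euclidean norm. -/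
abbrev E3 : Type := EuclideanSpace ℝ (Fin 3)

/-- The `i`-th standard basis vector of `ℝ²`. -/
def e2 (i : Fin 2) : E2 := EuclideanSpace.single i 1

/-- Partial derivative in the direction of the `i`-th coordinate. -/
def pd (i : Fin 2) (f : E2 → ℝ) (x : E2) : ℝ := fderiv ℝ f x (e2 i)

/-- Hessian matrix of a scalar function on `ℝ²`. -/
def hess (f : E2 → ℝ) (x : E2) : Matrix (Fin 2) (Fin 2) ℝ :=
  Matrix.of fun i j => pd i (pd j f) x

/-- Derivative matrix `Dy ∈ ℝ^{3×2}` of a map `y : ℝ² → ℝ³`. -/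
def Dmat (y : E2 → E3) (x : E2) : Matrix (Fin 3) (Fin 2) ℝ :=
  Matrix.of fun i j => pd j (fun z => y z i) x

/-- Induced metric `g_y = (Dy)ᵀ Dy`. -/
def gmet (y : E2 → E3) (x : E2) : Matrix (Fin 2) (Fin 2) ℝ :=
  (Dmat y x)ᵀ * Dmat y x

/-- The rotated vector `x⊥ = (-x₂, x₁)`. -/
def perpVec (x : E2) : Fin 2 → ℝ := ![-(x 1), x 0]

/-- The unit tangent `x̂⊥ = (-x₂, x₁)/|x|`. -/
def xperpUnit (x : E2) : Fin 2 → ℝ := fun i => perpVec x i / ‖x‖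

/-- The reference (cone) metric `g_Δ = Id - Δ² x̂⊥ ⊗ x̂⊥`. -/
def gDelta (Δ : ℝ) (x : E2) : Matrix (Fin 2) (Fin 2) ℝ :=
  1 - Matrix.of fun i j => (Δ ^ 2 / ‖x‖ ^ 2) * perpVec x i * perpVec x j

/-- Squared Frobenius norm of a matrix. -/
def frob2 {m n : Type*} [Fintype m] [Fintype n] (A : Matrix m n ℝ) : ℝ :=
  ∑ i, ∑ j, (A i j) ^ 2

/-- `|D²y|²`: the sum of the squared Frobenius norms of the Hessians of the components. -/
def hessNormSq (y : E2 → E3) (x : E2) : ℝ :=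
  ∑ i : Fin 3, frob2 (hess (fun z => y z i) x)

/-- The free elastic energy `I_{h,Δ}(y)`. -/
def energy (h Δ : ℝ) (y : E2 → E3) : ℝ :=
  ∫ x in ball (0 : E2) 1, (frob2 (gmet y x - gDelta Δ x) + h ^ 2 * hessNormSq y x)

/-- The singular cone `y^Δ(x) = √(1-Δ²)·(x,0) + Δ|x| e₃`. -/
def coneMap (Δ : ℝ) (x : E2) : E3 :=
  (WithLp.equiv 2 (Fin 3 → ℝ)).symm
    ![Real.sqrt (1 - Δ ^ 2) * x 0, Real.sqrt (1 - Δ ^ 2) * x 1, Δ * ‖x‖]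


/-- half isoperimetric -/
theorem lax_aux (a b : ℝ) (hab : a ≤ b) (y x' y' : ℝ → ℝ)
    (hy : ∀ t, HasDerivAt y (y' t) t)
    (cx : Continuous x') (cy : Continuous y') (ya : y a = 0) (yb : y b = 0) :
    ∫ t in a..b, y t * x' t ≤ (∫ t in a..b, √(x' t ^ 2 + y' t ^ 2)) ^ 2 / (2 * π) := by
  set s : ℝ → ℝ := fun t => √(x' t ^ 2 + y' t ^ 2) with hs
  have cs : Continuous s := by fun_prop
  have cyy : Continuous y := continuous_iff_continuousAt.2 fun t => (hy t).continuousAt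
  have s0 : ∀ t, 0 ≤ s t := fun t => Real.sqrt_nonneg _
  set l := ∫ t in a..b, s t with hl
  have l0 : 0 ≤ l := intervalIntegral.integral_nonneg hab fun t _ => s0 t
  have key : ∀ M, l < M → ∫ t in a..b, y t * x' t ≤ l * M / (2 * π) := by
    intro M hM
    have M0 : 0 < M := l0.trans_lt hM
    set c := π / M with hc
    have c0 : 0 < c := by positivity
    set e := π * (M - l) / (2 * M) with he
    have e0 : 0 < e := by have : 0 < M - l := by linarith
                          positivity
    set S : ℝ → ℝ := fun t => e + c * ∫ τ in a..t, s τ with hS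
    have dS : ∀ t, HasDerivAt S (c * s t) t := fun t =>
      ((intervalIntegral.integral_hasDerivAt_right (cs.intervalIntegrable _ _)
        (cs.stronglyMeasurableAtFilter _ _) cs.continuousAt).const_mul c).const_add e
    have cS : Continuous S := continuous_iff_continuousAt.2 fun t => (dS t).continuousAt
    have sp : ∀ t ∈ Set.uIcc a b, 0 < sin (S t) := by
      intro t ht
      rw [Set.uIcc_of_le hab] at ht
      have h1 : 0 ≤ ∫ τ in a..t, s τ := intervalIntegral.integral_nonneg ht.1 fun t _ => s0 t
      have h2 : 0 ≤ ∫ τ in t..b, s τ := intervalIntegral.integral_nonneg ht.2 fun t _ => s0 t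
      have h3 := intervalIntegral.integral_add_adjacent_intervals
        (cs.intervalIntegrable (μ := volume) a t) (cs.intervalIntegrable (μ := volume) t b)
      apply Real.sin_pos_of_pos_of_lt_pi
      · simp only [hS]; positivity
      · have h4 : (∫ τ in a..t, s τ) ≤ l := by rw [hl]; linarith
        have h5 : S t ≤ e + c * l := by simp only [hS]; gcongr
        have h6 : e + c * l = π - e := by simp only [he, hc]; field_simp; ring
        linarith
    set q : ℝ → ℝ := fun t => y t ^ 2 * (cos (S t) / sin (S t)) with hq
    set q' : ℝ → ℝ := fun t => 2 * y t * y' t * (cos (S t) / sin (S t)) -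
      y t ^ 2 * (c * s t) / sin (S t) ^ 2 with hq'
    have dq : ∀ t ∈ Set.uIcc a b, HasDerivAt q (q' t) t := by
      intro t ht
      have h0 := (sp t ht).ne'
      have h1 := ((hy t).pow 2).mul (((dS t).cos).div ((dS t).sin) h0)
      refine h1.congr_deriv ?_
      simp only [hq', Pi.pow_apply]
      have := sin_sq_add_cos_sq (S t)
      field_simp
      have h2 : cos (S t) ^ 2 = 1 - sin (S t) ^ 2 := by linarith
      push_cast
      simp only [Pi.div_apply]
      field_simp
      ring_nf
      rw [h2]; ring
    have cq' : ContinuousOn q' (Set.uIcc a b) := by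
      have h0 : ∀ t ∈ Set.uIcc a b, sin (S t) ≠ 0 := fun t ht => (sp t ht).ne'
      have h1 : ∀ t ∈ Set.uIcc a b, sin (S t) ^ 2 ≠ 0 := fun t ht => pow_ne_zero 2 (sp t ht).ne'
      simp only [hq']
      fun_prop (disch := assumption)
    have iq' : IntervalIntegrable q' volume a b := cq'.intervalIntegrable
    have hint := intervalIntegral.integral_eq_sub_of_hasDerivAt dq iq'
    have hq0 : q b - q a = 0 := by simp [hq, ya, yb]
    have hpt : ∀ t ∈ Set.Icc a b, 2 * (y t * x' t) ≤ s t / c - q' t := by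
      intro t ht
      have hp := sp t (by rwa [Set.uIcc_of_le hab])
      have hst : s t ^ 2 = x' t ^ 2 + y' t ^ 2 := Real.sq_sqrt (by positivity)
      simp only [hq']
      have h1 := sin_sq_add_cos_sq (S t)
      generalize sin (S t) = p at *
      generalize cos (S t) = k at *
      have h2 : x' t * p + y' t * k ≤ s t := by
        refine le_of_abs_le (abs_le_of_sq_le_sq ?_ (s0 t))
        rw [hst]
        nlinarith [sq_nonneg (x' t * k - y' t * p)]
      have h2' : -(x' t * p + y' t * k) ≤ s t := by
        refine le_of_abs_le (abs_le_of_sq_le_sq ?_ (s0 t))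
        rw [hst]
        nlinarith [sq_nonneg (x' t * k - y' t * p)]
      have h3 : y t * (x' t * p + y' t * k) ≤ |y t| * s t := by
        rcases abs_cases (y t) with ⟨h, h'⟩ | ⟨h, h'⟩ <;> rw [h] <;> nlinarith
      have h4 : 2 * |y t| * p ≤ p ^ 2 / c + c * y t ^ 2 := by
        have : p ^ 2 / c + c * y t ^ 2 - 2 * |y t| * p = (p - c * |y t|) ^ 2 / c := by
          field_simp; rw [← sq_abs (y t)]; ring
        have : 0 ≤ (p - c * |y t|) ^ 2 / c := by positivity
        linarith
      have h5 : 2 * (y t * x' t) * p ^ 2 + 2 * y t * y' t * k * p ≤ s t * (p ^ 2 / c + c * y t ^ 2) := by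
        calc _ = 2 * p * (y t * (x' t * p + y' t * k)) := by ring
          _ ≤ 2 * p * (|y t| * s t) := by gcongr
          _ = s t * (2 * |y t| * p) := by ring
          _ ≤ _ := by have := s0 t; gcongr
      have h6 : s t / c - (2 * y t * y' t * (k / p) - y t ^ 2 * (c * s t) / p ^ 2) - 2 * (y t * x' t)
        = (s t * (p ^ 2 / c + c * y t ^ 2) - (2 * (y t * x' t) * p ^ 2 + 2 * y t * y' t * k * p)) / p ^ 2 := by
        field_simp; ring
      have : 0 ≤ (s t * (p ^ 2 / c + c * y t ^ 2) - (2 * (y t * x' t) * p ^ 2 + 2 * y t * y' t * k * p)) / p ^ 2 :=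
        div_nonneg (by linarith) (by positivity)
      linarith
    have hm := intervalIntegral.integral_mono_on hab
      ((by fun_prop : Continuous fun t => 2 * (y t * x' t)).intervalIntegrable _ _)
      (((cs.div_const c).intervalIntegrable (μ := volume) a b).sub iq') hpt
    rw [intervalIntegral.integral_sub ((cs.div_const c).intervalIntegrable (μ := volume) a b) iq',
      intervalIntegral.integral_const_mul, intervalIntegral.integral_div, hint, hq0, ← hl] at hm
    have : l / c = l * M / π := by simp only [hc]; field_simp
    rw [this] at hm
    have : l * M / (2 * π) = l * M / π / 2 := by field_simp
    rw [this]; linarith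
  have : Tendsto (fun M => l * M / (2 * π)) (𝓝[>] l) (𝓝 (l * l / (2 * π))) := by
    apply Tendsto.mono_left _ nhdsWithin_le_nhds
    exact (by fun_prop : Continuous fun M => l * M / (2 * π)).tendsto l
  rw [sq]
  exact ge_of_tendsto this (eventually_mem_nhdsWithin.mono fun M hM => key M hM)

theorem lax_abs (a b : ℝ) (hab : a ≤ b) (y x' y' : ℝ → ℝ)
    (hy : ∀ t, HasDerivAt y (y' t) t)
    (cx : Continuous x') (cy : Continuous y') (ya : y a = 0) (yb : y b = 0) :
    |∫ t in a..b, y t * x' t| ≤ (∫ t in a..b, √(x' t ^ 2 + y' t ^ 2)) ^ 2 / (2 * π) := by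
  apply abs_le'.2
  constructor
  · exact lax_aux a b hab y x' y' hy cx cy ya yb
  · have := lax_aux a b hab y (fun t => - x' t) y' hy cx.neg cy ya yb
    simpa using this

/-- isoperimetric -/
theorem isop (a b : ℝ) (hab : a ≤ b) (f g f' g' : ℝ → ℝ)
    (hf : ∀ t, HasDerivAt f (f' t) t) (hg : ∀ t, HasDerivAt g (g' t) t)
    (cf : Continuous f') (cg : Continuous g') (pf : f b = f a) (pg : g b = g a) :
    4 * π * |(∫ t in a..b, (f t * g' t - g t * f' t)) / 2| ≤
      (∫ t in a..b, √(f' t ^ 2 + g' t ^ 2)) ^ 2 := by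
  set s : ℝ → ℝ := fun t => √(f' t ^ 2 + g' t ^ 2) with hs
  have cs : Continuous s := by fun_prop
  have cff : Continuous f := continuous_iff_continuousAt.2 fun t => (hf t).continuousAt
  have cgg : Continuous g := continuous_iff_continuousAt.2 fun t => (hg t).continuousAt
  have is : ∀ p q, IntervalIntegrable s volume p q := fun p q => cs.intervalIntegrable p q
  set L := ∫ t in a..b, s t with hL
  have L0 : 0 ≤ L := intervalIntegral.integral_nonneg hab fun t _ => Real.sqrt_nonneg _
  obtain ⟨m, hm, hmL⟩ : L / 2 ∈ (fun t => ∫ τ in a..t, s τ) '' Set.Icc a b := by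
    apply intermediate_value_Icc hab
    · exact (intervalIntegral.continuous_primitive is a).continuousOn
    · simp only [intervalIntegral.integral_same, ← hL]; constructor <;> linarith
  simp only at hmL
  have hmL2 : ∫ t in m..b, s t = L / 2 := by
    have := intervalIntegral.integral_add_adjacent_intervals (is a m) (is m b)
    rw [← hL] at this; linarith
  obtain ⟨n1, n2, hn, hn0⟩ : ∃ n1 n2 : ℝ, n1 ^ 2 + n2 ^ 2 = 1 ∧
      n1 * (f m - f a) + n2 * (g m - g a) = 0 := by
    set d := √((f m - f a) ^ 2 + (g m - g a) ^ 2) with hd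
    have hd2 : d ^ 2 = (f m - f a) ^ 2 + (g m - g a) ^ 2 := Real.sq_sqrt (by positivity)
    by_cases h : d = 0
    · refine ⟨1, 0, by norm_num, ?_⟩
      rw [h] at hd2
      have : f m - f a = 0 := by nlinarith [sq_nonneg (f m - f a), sq_nonneg (g m - g a)]
      rw [this]; ring
    · refine ⟨(g m - g a) / d, -(f m - f a) / d, ?_, ?_⟩
      · field_simp; rw [hd2]; ring
      · field_simp; ring
  set y : ℝ → ℝ := fun t => n1 * (f t - f a) + n2 * (g t - g a) with hyd
  set x : ℝ → ℝ := fun t => n2 * (f t - f a) - n1 * (g t - g a) with hxd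
  set y' : ℝ → ℝ := fun t => n1 * f' t + n2 * g' t with hyd'
  set x' : ℝ → ℝ := fun t => n2 * f' t - n1 * g' t with hxd'
  have hy : ∀ t, HasDerivAt y (y' t) t := fun t =>
    (((hf t).sub_const _).const_mul n1).add (((hg t).sub_const _).const_mul n2)
  have hx : ∀ t, HasDerivAt x (x' t) t := fun t =>
    (((hf t).sub_const _).const_mul n2).sub (((hg t).sub_const _).const_mul n1)
  have cx : Continuous x' := by fun_prop
  have cy : Continuous y' := by fun_prop
  have ccx : Continuous x := by fun_prop
  have ccy : Continuous y := by fun_prop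
  have hss : ∀ t, √(x' t ^ 2 + y' t ^ 2) = s t := by
    intro t
    simp only [hs, hxd', hyd']
    congr 1
    linear_combination (f' t ^ 2 + g' t ^ 2) * hn
  have ya : y a = 0 := by simp [hyd]
  have yb : y b = 0 := by simp [hyd, pf, pg]
  have h1 := lax_abs a m hm.1 y x' y' hy cx cy ya hn0
  have h2 := lax_abs m b hm.2 y x' y' hy cx cy hn0 yb
  simp only [hss] at h1 h2
  rw [hmL] at h1
  rw [hmL2] at h2
  have iyx : ∀ p q, IntervalIntegrable (fun t => y t * x' t) volume p q :=
    fun p q => (by fun_prop : Continuous fun t => y t * x' t).intervalIntegrable p q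
  have hadd := intervalIntegral.integral_add_adjacent_intervals (iyx a m) (iyx m b)
  have hA : (∫ t in a..b, (f t * g' t - g t * f' t)) / 2 = - ∫ t in a..b, y t * x' t := by
    have hd : ∀ t, HasDerivAt (fun t => x t * y t + f a * g t - g a * f t)
        (f t * g' t - g t * f' t + 2 * (y t * x' t)) t := by
      intro t
      refine ((((hx t).mul (hy t)).add ((hg t).const_mul (f a))).sub ((hf t).const_mul (g a))).congr_deriv ?_
      simp only [hxd, hyd, hxd', hyd']
      linear_combination ((f t - f a) * g' t - (g t - g a) * f' t) * hn
    have i1 : IntervalIntegrable (fun t => f t * g' t - g t * f' t) volume a b :=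
      (by fun_prop : Continuous fun t => f t * g' t - g t * f' t).intervalIntegrable _ _
    have i2 := (iyx a b).const_mul 2
    have := intervalIntegral.integral_eq_sub_of_hasDerivAt (fun t _ => hd t) (i1.add i2)
    rw [intervalIntegral.integral_add i1 i2, intervalIntegral.integral_const_mul] at this
    simp only [ya, yb, pf, pg] at this
    linarith
  rw [hA, abs_neg, ← hadd]
  have h3 := abs_add_le (∫ t in a..m, y t * x' t) (∫ t in m..b, y t * x' t)
  have h4 : 4 * π * ((L / 2) ^ 2 / (2 * π) + (L / 2) ^ 2 / (2 * π)) = L ^ 2 := by field_simp; ring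
  rw [← h4]
  gcongr
  linarith

theorem green_polar (F G Fr Gr Ft Gt : ℝ → ℝ → ℝ)
    (hFr : ∀ p t, HasDerivAt (fun p => F p t) (Fr p t) p)
    (hGr : ∀ p t, HasDerivAt (fun p => G p t) (Gr p t) p)
    (hFt : ∀ p t, HasDerivAt (fun t => F p t) (Ft p t) t)
    (hGt : ∀ p t, HasDerivAt (fun t => G p t) (Gt p t) t)
    (cF : Continuous (Function.uncurry F)) (cG : Continuous (Function.uncurry G))
    (cFr : Continuous (Function.uncurry Fr)) (cGr : Continuous (Function.uncurry Gr))
    (cFt : Continuous (Function.uncurry Ft)) (cGt : Continuous (Function.uncurry Gt))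
    (a b : ℝ) (pF : ∀ p, F p b = F p a) (pG : ∀ p, G p b = G p a)
    (F0 : ∀ t, Ft 0 t = 0) (G0 : ∀ t, Gt 0 t = 0) (r : ℝ) :
    ∫ p in (0 : ℝ)..r, ∫ t in a..b, (Fr p t * Gt p t - Gr p t * Ft p t) =
      (∫ t in a..b, (F r t * Gt r t - G r t * Ft r t)) / 2 := by
  have sec : ∀ {H : ℝ → ℝ → ℝ}, Continuous (Function.uncurry H) → ∀ p, Continuous (H p) :=
    fun h p => h.comp (by fun_prop : Continuous fun t : ℝ => (p, t))
  have sec' : ∀ {H : ℝ → ℝ → ℝ}, Continuous (Function.uncurry H) → ∀ t, Continuous (fun p => H p t) :=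
    fun h p => h.comp (by fun_prop : Continuous fun t : ℝ => (t, p))
  -- slope bound
  have bd : ∀ (H Hr : ℝ → ℝ → ℝ), (∀ p t, HasDerivAt (fun p => H p t) (Hr p t) p) →
      Continuous (Function.uncurry Hr) → ∀ p0, ∃ C, ∀ p ∈ ball p0 1, ∀ t ∈ Set.uIcc a b,
        |slope (fun p => H p t) p0 p| ≤ C := by
    intro H Hr hH cH p0
    obtain ⟨C, hC⟩ := ((isCompact_closedBall p0 1).prod (isCompact_uIcc (a := a) (b := b))).exists_bound_of_continuousOn cH.continuousOn
    refine ⟨max C 0, fun p hp t ht => ?_⟩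
    have := Convex.norm_image_sub_le_of_norm_hasDerivWithin_le (f := fun p => H p t) (f' := fun p => Hr p t) (s := closedBall p0 1) (x := p0) (y := p) (C := C)
      (fun q _ => (hH q t).hasDerivWithinAt) (fun q hq => hC (q, t) ⟨hq, ht⟩)
      (convex_closedBall _ _) (mem_closedBall_self zero_le_one) (ball_subset_closedBall hp)
    rw [slope_def_field, abs_div]
    apply div_le_of_le_mul₀ (abs_nonneg _) (le_max_right _ _)
    refine this.trans ?_
    rw [Real.norm_eq_abs]
    gcongr
    exact le_max_left _ _
  have bdc : ∀ (H : ℝ → ℝ → ℝ), Continuous (Function.uncurry H) → ∀ p0, ∃ C, ∀ p ∈ ball p0 1, ∀ t ∈ Set.uIcc a b,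
        |H p t| ≤ C := by
    intro H cH p0
    obtain ⟨C, hC⟩ := ((isCompact_closedBall p0 1).prod (isCompact_uIcc (a := a) (b := b))).exists_bound_of_continuousOn cH.continuousOn
    exact ⟨C, fun p hp t ht => hC (p, t) ⟨ball_subset_closedBall hp, ht⟩⟩
  set A : ℝ → ℝ := fun p => (∫ t in a..b, (F p t * Gt p t - G p t * Ft p t)) / 2 with hA
  set B : ℝ → ℝ := fun p => ∫ t in a..b, (Fr p t * Gt p t - Gr p t * Ft p t) with hB
  have slopeA : ∀ p0 p, slope A p0 p = ∫ t in a..b,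
      (slope (fun p => F p t) p0 p * (Gt p t + Gt p0 t)
        - slope (fun p => G p t) p0 p * (Ft p t + Ft p0 t)) / 2 := by
    intro p0 p
    have c1 := sec cF p; have c2 := sec cF p0; have c3 := sec cG p; have c4 := sec cG p0
    have c5 := sec cFt p; have c6 := sec cFt p0; have c7 := sec cGt p; have c8 := sec cGt p0
    simp only [slope_def_field, hA]
    rw [← sub_div, ← intervalIntegral.integral_sub
      (Continuous.intervalIntegrable (by fun_prop) _ _) (Continuous.intervalIntegrable (by fun_prop) _ _),
      ← intervalIntegral.integral_div, ← intervalIntegral.integral_div, ← sub_eq_zero,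
      ← intervalIntegral.integral_sub
      (Continuous.intervalIntegrable (by fun_prop) _ _) (Continuous.intervalIntegrable (by fun_prop) _ _)]
    have hd : ∀ t, HasDerivAt (fun t => (F p0 t * G p t - F p t * G p0 t) / 2 / (p - p0))
        ((F p t * Gt p t - G p t * Ft p t - (F p0 t * Gt p0 t - G p0 t * Ft p0 t)) / 2 / (p - p0) -
      ((F p t - F p0 t) / (p - p0) * (Gt p t + Gt p0 t) -
          (G p t - G p0 t) / (p - p0) * (Ft p t + Ft p0 t)) / 2) t := by
      intro t
      refine (((((hFt p0 t).mul (hGt p t)).sub ((hFt p t).mul (hGt p0 t))).div_const 2).div_const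
        (p - p0)).congr_deriv ?_
      ring
    rw [intervalIntegral.integral_eq_sub_of_hasDerivAt (fun t _ => hd t)
      (Continuous.intervalIntegrable (by fun_prop) _ _)]
    simp [pF, pG]
  have dA : ∀ p0, HasDerivAt A (B p0) p0 := by
    intro p0
    rw [hasDerivAt_iff_tendsto_slope]
    have e1 : slope A p0 = fun p => ∫ t in a..b,
      (slope (fun p => F p t) p0 p * (Gt p t + Gt p0 t)
        - slope (fun p => G p t) p0 p * (Ft p t + Ft p0 t)) / 2 := funext (slopeA p0)
    rw [e1]
    obtain ⟨C1, h1⟩ := bd F Fr hFr cFr p0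
    obtain ⟨C2, h2⟩ := bd G Gr hGr cGr p0
    obtain ⟨C3, h3⟩ := bdc Ft cFt p0
    obtain ⟨C4, h4⟩ := bdc Gt cGt p0
    apply intervalIntegral.tendsto_integral_filter_of_dominated_convergence
      (fun _ => (C1 * (C4 + C4) + C2 * (C3 + C3)) / 2)
    · refine Eventually.of_forall fun p => ?_
      have c1 := sec cF p; have c2 := sec cF p0; have c3 := sec cG p; have c4 := sec cG p0
      have c5 := sec cFt p; have c6 := sec cFt p0; have c7 := sec cGt p; have c8 := sec cGt p0
      simp only [slope_def_field]
      exact Continuous.aestronglyMeasurable (by fun_prop)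
    · filter_upwards [mem_nhdsWithin_of_mem_nhds (ball_mem_nhds p0 one_pos)] with p hp
      refine Eventually.of_forall fun t ht => ?_
      have ht := Set.uIoc_subset_uIcc ht
      have hp0 := mem_ball_self (x := p0) (one_pos : (0:ℝ) < 1)
      rw [norm_div, Real.norm_eq_abs, Real.norm_eq_abs, abs_two]
      gcongr
      refine (abs_sub _ _).trans ?_
      rw [abs_mul, abs_mul]
      have := h1 p hp t ht
      have := h2 p hp t ht
      have := (abs_add_le (Gt p t) (Gt p0 t)).trans (add_le_add (h4 p hp t ht) (h4 p0 hp0 t ht))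
      have := (abs_add_le (Ft p t) (Ft p0 t)).trans (add_le_add (h3 p hp t ht) (h3 p0 hp0 t ht))
      have : 0 ≤ C1 := (abs_nonneg _).trans (h1 p hp t ht)
      have : 0 ≤ C2 := (abs_nonneg _).trans (h2 p hp t ht)
      gcongr
    · exact intervalIntegrable_const
    · refine Eventually.of_forall fun t ht => ?_
      have k1 := hasDerivAt_iff_tendsto_slope.1 (hFr p0 t)
      have k2 := hasDerivAt_iff_tendsto_slope.1 (hGr p0 t)
      have k3 := ((sec' cFt t).tendsto p0).mono_left (nhdsWithin_le_nhds (s := {p0}ᶜ))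
      have k4 := ((sec' cGt t).tendsto p0).mono_left (nhdsWithin_le_nhds (s := {p0}ᶜ))
      have := ((k1.mul (k4.add_const (Gt p0 t))).sub (k2.mul (k3.add_const (Ft p0 t)))).div_const 2
      convert this using 2
      ring
  have cB : Continuous B := by
    apply intervalIntegral.continuous_parametric_intervalIntegral_of_continuous'
    exact (cFr.mul cGt).sub (cGr.mul cFt)
  have := intervalIntegral.integral_eq_sub_of_hasDerivAt (fun t _ => dA t) (cB.intervalIntegrable 0 r)
  rw [this]
  simp [hA, F0, G0]

/-- polar parametrisation -/
def PP (p t : ℝ) : E2 := !₂[p * cos t, p * sin t]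

theorem PP_cont : Continuous (Function.uncurry PP) := by
  unfold PP Function.uncurry
  apply (PiLp.continuous_toLp 2 _).comp
  apply continuous_pi
  intro i
  fin_cases i <;> simp <;> fun_prop

theorem norm_PP (p t : ℝ) : ‖PP p t‖ = |p| := by
  rw [EuclideanSpace.norm_eq, ← Real.sqrt_sq_eq_abs]
  simp only [PP, Fin.sum_univ_two, Real.norm_eq_abs, sq_abs]
  congr 1
  simp
  nlinarith [sin_sq_add_cos_sq t]

theorem dist_PP (p s t : ℝ) (hp : 0 ≤ p) : dist (PP p s) (PP p t) = p * (2 * |sin ((s - t) / 2)|) := by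
  have : p * (2 * |sin ((s - t) / 2)|) = |p * (2 * sin ((s - t) / 2))| := by
    rw [abs_mul, abs_mul, abs_of_nonneg hp, abs_two]
  rw [this, EuclideanSpace.dist_eq, ← Real.sqrt_sq_eq_abs]
  congr 1
  simp only [PP, Fin.sum_univ_two, Real.dist_eq, sq_abs]
  simp
  have h1 : s = t + 2 * ((s - t) / 2) := by ring
  generalize (s - t) / 2 = w at *
  subst h1
  have h2 : (p * cos (t + 2 * w) - p * cos t) ^ 2 + (p * sin (t + 2 * w) - p * sin t) ^ 2 =
    p ^ 2 * (2 - 2 * (cos (t + 2 * w) * cos t + sin (t + 2 * w) * sin t)) := by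
    linear_combination p ^ 2 * sin_sq_add_cos_sq t + p ^ 2 * sin_sq_add_cos_sq (t + 2 * w)
  rw [h2, ← cos_sub, show t + 2 * w - t = 2 * w by ring, cos_two_mul]
  linear_combination (-4) * p ^ 2 * sin_sq_add_cos_sq w

theorem polar_ball (f : E2 → ℝ) (cf : Continuous f) (r : ℝ) (hr : 0 < r) :
    ∫ x in ball (0 : E2) r, f x = ∫ p in (0:ℝ)..r, ∫ t in (-π)..π, p * f (PP p t) := by
  have e : MeasurePreserving (fun q : ℝ × ℝ => (!₂[q.1, q.2] : E2)) volume volume :=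
    (PiLp.volume_preserving_toLp (Fin 2)).comp (volume_preserving_finTwoArrow ℝ).symm
  have me : MeasurableEmbedding (fun q : ℝ × ℝ => (!₂[q.1, q.2] : E2)) :=
    (MeasurableEquiv.toLp 2 (Fin 2 → ℝ)).measurableEmbedding.comp
      (MeasurableEquiv.finTwoArrow (α := ℝ)).symm.measurableEmbedding
  rw [← integral_indicator measurableSet_ball, ← e.integral_comp me, ← integral_comp_polarCoord_symm,
    polarCoord_target]
  have h1 : ∀ p ∈ Set.Ioi (0:ℝ) ×ˢ Set.Ioo (-π) π,
      p.1 • (ball (0:E2) r).indicator f !₂[(polarCoord.symm p).1, (polarCoord.symm p).2] =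
      (Set.Iio r ×ˢ (Set.univ : Set ℝ)).indicator (fun p => p.1 * f (PP p.1 p.2)) p := by
    rintro ⟨p, t⟩ ⟨hp, ht⟩
    have : (!₂[(polarCoord.symm (p, t)).1, (polarCoord.symm (p, t)).2] : E2) = PP p t := by
      simp [PP, polarCoord_symm_apply]
    rw [this]
    have hp : 0 < p := hp
    by_cases h : p < r
    · rw [Set.indicator_of_mem, Set.indicator_of_mem]
      · rfl
      · simpa using h
      · simpa [norm_PP, abs_of_pos hp] using h
    · rw [Set.indicator_of_notMem, Set.indicator_of_notMem]
      · simp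
      · simpa using h
      · simpa [norm_PP, abs_of_pos hp] using h
  rw [setIntegral_congr_fun (measurableSet_Ioi.prod measurableSet_Ioo) h1,
    setIntegral_indicator (measurableSet_Iio.prod MeasurableSet.univ), Set.prod_inter_prod,
    Set.inter_univ, Set.Ioi_inter_Iio]
  have cc : Continuous fun p : ℝ × ℝ => p.1 * f (PP p.1 p.2) :=
    continuous_fst.mul (cf.comp PP_cont)
  have ii : IntegrableOn (fun p : ℝ × ℝ => p.1 * f (PP p.1 p.2)) (Set.Ioo 0 r ×ˢ Set.Ioo (-π) π)
      (volume.prod volume) :=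
    (cc.continuousOn.integrableOn_compact (isCompact_Icc.prod isCompact_Icc)).mono_set
      (Set.prod_mono Set.Ioo_subset_Icc_self Set.Ioo_subset_Icc_self)
  rw [Measure.volume_eq_prod, setIntegral_prod _ ii, intervalIntegral.integral_of_le hr.le,
    integral_Ioc_eq_integral_Ioo]
  simp_rw [intervalIntegral.integral_of_le (by linarith [pi_pos] : -π ≤ π),
    integral_Ioc_eq_integral_Ioo]

theorem sphere_fin (r : ℝ) (hr : 0 < r) : μH[1] (sphere (0:E2) r) < ⊤ := by
  have hsub : sphere (0:E2) r ⊆ PP r '' Set.Icc (-π) π := by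
    intro x hx
    have hx : ‖x‖ = r := by simpa using hx
    have h2 : x 0 ^ 2 + x 1 ^ 2 = r ^ 2 := by
      rw [← hx, EuclideanSpace.norm_eq, Real.sq_sqrt (by positivity)]; simp
    set z : ℂ := ⟨x 0, x 1⟩ with hz
    have hn : ‖z‖ = r := by
      rw [Complex.norm_eq_sqrt_sq_add_sq, h2, Real.sqrt_sq hr.le]
    refine ⟨z.arg, ⟨(Complex.neg_pi_lt_arg z).le, Complex.arg_le_pi z⟩, ?_⟩
    ext i
    fin_cases i
    · simp [PP, ← hn]; rfl
    · simp [PP, ← hn]; rfl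
  have hL : LipschitzWith (Real.toNNReal r) (PP r) := by
    apply LipschitzWith.of_dist_le_mul
    intro s t
    rw [dist_PP _ _ _ hr.le, Real.coe_toNNReal _ hr.le, Real.dist_eq]
    gcongr
    have := abs_sin_le_abs (x := (s - t) / 2)
    rw [abs_div, abs_two] at this
    linarith
  refine (measure_mono hsub).trans_lt ((hL.hausdorffMeasure_image_le zero_le_one _).trans_lt ?_)
  rw [hausdorffMeasure_real]
  simp [ENNReal.mul_lt_top]

theorem haus_lower (r : ℝ) (hr : 0 < r) (c : ℝ) (hc0 : 0 < c) (hc : c < 1) (A : Set E2)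
    (hA : MeasurableSet A) :
    ENNReal.ofReal (r * c) * volume (PP r ⁻¹' A ∩ Set.Ioo (-π) π) ≤ μH[1] (A ∩ sphere 0 r) := by
  have cP : Continuous (PP r) := PP_cont.comp (by fun_prop : Continuous fun t : ℝ => (r, t))
  obtain ⟨d, d0, hd⟩ : ∃ d > 0, ∀ w : ℝ, |w| < d → c * |w| ≤ |sin w| := by
    have h := Real.hasDerivAt_sin 0
    rw [cos_zero, hasDerivAt_iff_isLittleO_nhds_zero] at h
    have h := h.def (sub_pos.2 hc)
    obtain ⟨d, d0, hd⟩ := Metric.eventually_nhds_iff.1 h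
    refine ⟨d, d0, fun w hw => ?_⟩
    have := hd (y := w) (by simpa using hw)
    simp at this
    have h2 := abs_sub_abs_le_abs_sub w (sin w)
    rw [abs_sub_comm] at h2
    linarith
  set T := PP r ⁻¹' A ∩ Set.Ioo (-π) π with hT
  have mT : MeasurableSet T := (cP.measurable hA).inter measurableSet_Ioo
  set I : ℤ → Set ℝ := fun n => Set.Ico (n • d) ((n + 1) • d) with hI
  have hU : T = ⋃ n, T ∩ I n := by
    rw [← Set.inter_iUnion, iUnion_Ico_zsmul d0, Set.inter_univ]
  have hdis : Pairwise (Function.onFun Disjoint fun n => T ∩ I n) := by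
    intro m n hmn
    exact (Set.pairwise_disjoint_Ico_zsmul d hmn).mono Set.inter_subset_right Set.inter_subset_right
  have hmeas : ∀ n, MeasurableSet (T ∩ I n) := fun n => mT.inter measurableSet_Ico
  have inj : Set.InjOn (PP r) T := by
    intro s hs t ht hst
    have h := dist_PP r s t hr.le
    rw [hst, dist_self] at h
    have h1 : sin ((s - t) / 2) = 0 := by
      rcases mul_eq_zero.1 h.symm with h | h
      · linarith
      · simpa using h
    have := (sin_eq_zero_iff_of_lt_of_lt (by linarith [hs.2.1, ht.2.2]) (by linarith [hs.2.2, ht.2.1])).1 h1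
    linarith
  have piece : ∀ n, ENNReal.ofReal (r * c) * volume (T ∩ I n) ≤ μH[1] (PP r '' (T ∩ I n)) := by
    intro n
    have rc : 0 < r * c := by positivity
    have hl : AntilipschitzWith (Real.toNNReal (r * c)⁻¹) ((T ∩ I n).domRestrict (PP r)) := by
      apply AntilipschitzWith.of_le_mul_dist
      rintro ⟨s, hs⟩ ⟨t, ht⟩
      simp only [Set.domRestrict_apply]
      rw [dist_PP _ _ _ hr.le, Real.coe_toNNReal _ (by positivity), Subtype.dist_eq, Real.dist_eq]
      have hst : |s - t| < d := by
        have h1 := hs.2; have h2 := ht.2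
        simp only [hI, Set.mem_Ico, add_smul, one_smul] at h1 h2
        rw [abs_lt]; constructor <;> linarith
      have := hd ((s - t) / 2) (by rw [abs_div, abs_two]; linarith [abs_nonneg (s - t)])
      rw [abs_div, abs_two] at this
      rw [inv_mul_eq_div, le_div_iff₀ rc]
      calc |s - t| * (r * c) = r * (2 * (c * (|s - t| / 2))) := by ring
        _ ≤ _ := by gcongr
    have h := hl.le_hausdorffMeasure_image (zero_le_one) Set.univ
    rw [Set.image_univ, Set.range_domRestrict] at h
    have h3 : μH[1] (Set.univ : Set (T ∩ I n : Set ℝ)) = volume (T ∩ I n) := by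
      rw [← (isometry_subtype_coe (s := T ∩ I n)).hausdorffMeasure_image (Or.inl zero_le_one),
        hausdorffMeasure_real, Set.image_univ, Subtype.range_coe]
    rw [h3] at h
    calc _ ≤ ENNReal.ofReal (r * c) * _ := mul_le_mul_right h _
      _ = _ := by
        rw [ENNReal.rpow_one, ← mul_assoc, ← ENNReal.ofReal.eq_1, ← ENNReal.ofReal_mul rc.le,
          mul_inv_cancel₀ rc.ne', ENNReal.ofReal_one, one_mul]
  calc ENNReal.ofReal (r * c) * volume T = ∑' n, ENNReal.ofReal (r * c) * volume (T ∩ I n) := by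
        rw [ENNReal.tsum_mul_left, ← measure_iUnion hdis hmeas, ← hU]
    _ ≤ ∑' n, μH[1] (PP r '' (T ∩ I n)) := ENNReal.tsum_le_tsum piece
    _ = μH[1] (⋃ n, PP r '' (T ∩ I n)) := by
        rw [measure_iUnion]
        · intro m n hmn
          rw [Function.onFun, Set.disjoint_iff_inter_eq_empty, ← inj.image_inter Set.inter_subset_left Set.inter_subset_left,
            Set.disjoint_iff_inter_eq_empty.1 (hdis hmn), Set.image_empty]
        · intro n
          exact (hmeas n).image_of_continuousOn_injOn cP.continuousOn (inj.mono Set.inter_subset_left)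
    _ ≤ _ := by
        apply measure_mono
        apply Set.iUnion_subset
        rintro n _ ⟨t, ht, rfl⟩
        exact ⟨ht.1.1, by simp [norm_PP, abs_of_pos hr]⟩

theorem sphere_lower (r : ℝ) (hr : 0 < r) (f : E2 → ℝ) (f0 : ∀ x, 0 ≤ f x)
    (cf : ContinuousOn f (sphere 0 r)) (mf : Measurable f) :
    ∫ t in (-π)..π, r * f (PP r t) ≤ ∫ x in sphere (0:E2) r, f x ∂μH[1] := by
  have cP : Continuous (PP r) := PP_cont.comp (by fun_prop : Continuous fun t : ℝ => (r, t))
  have hint : IntegrableOn f (sphere 0 r) μH[1] := by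
    obtain ⟨C, hC⟩ := (isCompact_sphere (0:E2) r).exists_bound_of_continuousOn cf
    exact IntegrableOn.of_bound (sphere_fin r hr) mf.aestronglyMeasurable C
      (ae_restrict_of_forall_mem isClosed_sphere.measurableSet hC)
  have key : ∀ c, c ∈ Set.Ioo (0:ℝ) 1 → c * ∫ t in (-π)..π, r * f (PP r t) ≤ ∫ x in sphere (0:E2) r, f x ∂μH[1] := by
    intro c hc
    set ν : Measure E2 := ENNReal.ofReal (r * c) • (volume.restrict (Set.Ioo (-π) π)).map (PP r) with hν
    have hle : ν ≤ μH[1].restrict (sphere 0 r) := by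
      apply Measure.le_iff.2
      intro A hA
      rw [Measure.restrict_apply hA, hν, Measure.smul_apply, Measure.map_apply cP.measurable hA,
        Measure.restrict_apply (cP.measurable hA), smul_eq_mul]
      exact haus_lower r hr c hc.1 hc.2 A hA
    have := integral_mono_measure hle (Eventually.of_forall f0) hint
    refine le_of_eq_of_le ?_ this
    rw [hν, integral_smul_measure, integral_map cP.aemeasurable mf.aestronglyMeasurable,
      ENNReal.toReal_ofReal (mul_pos hr hc.1).le, intervalIntegral.integral_const_mul, 
      intervalIntegral.integral_of_le (by linarith [pi_pos] : -π ≤ π), integral_Ioc_eq_integral_Ioo, smul_eq_mul]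
    ring
  have ht : Tendsto (fun c => c * ∫ t in (-π)..π, r * f (PP r t)) (𝓝[<] 1) (𝓝 (1 * ∫ t in (-π)..π, r * f (PP r t))) := 
    Tendsto.mono_left ((by fun_prop : Continuous fun c => c * ∫ t in (-π)..π, r * f (PP r t)).tendsto 1) nhdsWithin_le_nhds
  rw [one_mul] at ht
  exact le_of_tendsto ht (Filter.mem_of_superset (Ioo_mem_nhdsLT zero_lt_one) key)


theorem pd_contDiff (v : E2 → ℝ) (hv : ContDiff ℝ 2 v) (i : Fin 2) : ContDiff ℝ 1 (pd i v) :=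
  (hv.fderiv_right (m := 1) (by norm_num)).clm_apply contDiff_const

theorem pd_cont (f : E2 → ℝ) (hf : ContDiff ℝ 1 f) (i : Fin 2) : Continuous (pd i f) :=
  (hf.continuous_fderiv one_ne_zero).clm_apply continuous_const

theorem fderiv_eq_pd (f : E2 → ℝ) (x : E2) (a b : ℝ) :
    fderiv ℝ f x !₂[a, b] = a * pd 0 f x + b * pd 1 f x := by
  have : (!₂[a, b] : E2) = a • e2 0 + b • e2 1 := by
    ext i; fin_cases i <;> simp [e2]
  rw [this, map_add, map_smul, map_smul]
  rfl

theorem pd_symm (v : E2 → ℝ) (hv : ContDiff ℝ 2 v) (i j : Fin 2) (x : E2) :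
    pd i (pd j v) x = pd j (pd i v) x := by
  have hd : DifferentiableAt ℝ (fderiv ℝ v) x :=
    (hv.fderiv_right (m := 1) (by norm_num)).differentiable one_ne_zero x
  have h : ∀ i j, pd i (pd j v) x = fderiv ℝ (fderiv ℝ v) x (e2 i) (e2 j) := by
    intro i j
    have : pd j v = fun y => fderiv ℝ v y (e2 j) := rfl
    rw [this, pd, fderiv_clm_apply hd (differentiableAt_const _)]
    simp
  rw [h, h]
  exact (hv.contDiffAt.isSymmSndFDerivAt (by simp)) (e2 i) (e2 j)

theorem PP_dr (p t : ℝ) : HasDerivAt (fun p => PP p t) !₂[cos t, sin t] p := by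
  refine (PiLp.continuousLinearEquiv 2 ℝ (fun _ : Fin 2 => ℝ)).symm.hasFDerivAt.comp_hasDerivAt (f := fun q => (PP q t).ofLp) _
    (hasDerivAt_pi.2 ?_)
  intro i
  fin_cases i
  · simpa [PP] using (hasDerivAt_id p).mul_const (cos t)
  · simpa [PP] using (hasDerivAt_id p).mul_const (sin t)

theorem PP_dt (p t : ℝ) : HasDerivAt (fun t => PP p t) !₂[-(p * sin t), p * cos t] t := by
  refine (PiLp.continuousLinearEquiv 2 ℝ (fun _ : Fin 2 => ℝ)).symm.hasFDerivAt.comp_hasDerivAt (f := fun q => (PP p q).ofLp) _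
    (hasDerivAt_pi.2 ?_)
  intro i
  fin_cases i
  · simpa [PP] using (hasDerivAt_cos t).const_mul p
  · simpa [PP] using (hasDerivAt_sin t).const_mul p

theorem comp_dr (f : E2 → ℝ) (hf : ContDiff ℝ 1 f) (p t : ℝ) : HasDerivAt (fun p => f (PP p t))
    (cos t * pd 0 f (PP p t) + sin t * pd 1 f (PP p t)) p := by
  rw [← fderiv_eq_pd]
  exact ((hf.differentiable one_ne_zero) (PP p t)).hasFDerivAt.comp_hasDerivAt p (PP_dr p t)

theorem comp_dt (f : E2 → ℝ) (hf : ContDiff ℝ 1 f) (p t : ℝ) : HasDerivAt (fun t => f (PP p t))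
    (-(p * sin t) * pd 0 f (PP p t) + p * cos t * pd 1 f (PP p t)) t := by
  rw [← fderiv_eq_pd]
  exact ((hf.differentiable one_ne_zero) (PP p t)).hasFDerivAt.comp_hasDerivAt t (PP_dt p t)

theorem green_ball (f g : E2 → ℝ) (hf : ContDiff ℝ 1 f) (hg : ContDiff ℝ 1 g) (r : ℝ) (hr : 0 < r) :
    ∫ x in ball (0 : E2) r, (pd 0 f x * pd 1 g x - pd 0 g x * pd 1 f x) =
    (∫ t in (-π)..π, (f (PP r t) * (-(r * sin t) * pd 0 g (PP r t) + r * cos t * pd 1 g (PP r t))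
      - g (PP r t) * (-(r * sin t) * pd 0 f (PP r t) + r * cos t * pd 1 f (PP r t)))) / 2 := by
  have cPP : Continuous fun q : ℝ × ℝ => PP q.1 q.2 := PP_cont
  have c0 := pd_cont f hf 0
  have c1 := pd_cont f hf 1
  have c2 := pd_cont g hg 0
  have c3 := pd_cont g hg 1
  have c4 := hf.continuous
  have c5 := hg.continuous
  have per : ∀ p, PP p π = PP p (-π) := by intro p; simp [PP]
  rw [polar_ball _ (by fun_prop) r hr]
  have h := green_polar (fun p t => f (PP p t)) (fun p t => g (PP p t)) _ _ _ _
    (comp_dr f hf) (comp_dr g hg) (comp_dt f hf) (comp_dt g hg)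
    (by unfold Function.uncurry; fun_prop) (by unfold Function.uncurry; fun_prop)
    (by unfold Function.uncurry; fun_prop) (by unfold Function.uncurry; fun_prop)
    (by unfold Function.uncurry; fun_prop) (by unfold Function.uncurry; fun_prop)
    (-π) π (by simp [per]) (by simp [per]) (by simp) (by simp) r
  rw [← h]
  congr 1; ext p; congr 1; ext t
  linear_combination (-p * (pd 0 f (PP p t) * pd 1 g (PP p t) - pd 0 g (PP p t) * pd 1 f (PP p t)))
    * sin_sq_add_cos_sq t


/-- isoperimetric inequality with the tangential part of the Hessian. -/
theorem stmt_5 (v : E2 → ℝ) (hv : ContDiff ℝ 2 v) (r : ℝ) (hr : r ∈ Set.Ioc (0 : ℝ) 1) :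
    Real.sqrt (4 * π * |∫ x in ball (0 : E2) r, (hess v x).det|) ≤
      ∫ x in sphere (0 : E2) r,
        Real.sqrt (∑ j, ((hess v x).mulVec (xperpUnit x) j) ^ 2) ∂μH[1] := by
  have r0 := hr.1
  have c : ∀ k, ContDiff ℝ 1 (pd k v) := pd_contDiff v hv
  have cc : ∀ i k, Continuous (pd i (pd k v)) := fun i k => pd_cont _ (c k) i
  have cP : Continuous (PP r) := PP_cont.comp (by fun_prop : Continuous fun t : ℝ => (r, t))
  set u : E2 → ℝ := fun x => √(∑ j, ((hess v x).mulVec (xperpUnit x) j) ^ 2) with hu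
  have hform : ∀ x, u x = √(∑ j, (pd j (pd 0 v) x * (-(x 1) / ‖x‖) + pd j (pd 1 v) x * (x 0 / ‖x‖)) ^ 2) := by
    intro x
    simp [hu, hess, Matrix.mulVec, dotProduct, xperpUnit, perpVec, Fin.sum_univ_two]
  have hu' : u = fun x => √(∑ j, (pd j (pd 0 v) x * (-(x 1) / ‖x‖) + pd j (pd 1 v) x * (x 0 / ‖x‖)) ^ 2) :=
    funext hform
  have mu : Measurable u := by
    rw [hu']
    have := fun i k => (cc i k).measurable
    have m0 : ∀ i, Measurable fun x : E2 => x i := fun i => by fun_prop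
    have := m0 0
    have := m0 1
    fun_prop
  have cu : ContinuousOn u (sphere 0 r) := by
    rw [hu']
    have : ∀ x ∈ sphere (0:E2) r, ‖x‖ ≠ 0 := by
      intro x hx
      have : ‖x‖ = r := by simpa using hx
      rw [this]; exact r0.ne'
    have := fun i k => (cc i k).continuousOn (s := sphere 0 r)
    fun_prop (disch := assumption)
  have hlow := sphere_lower r r0 u (fun x => Real.sqrt_nonneg _) cu mu
  refine le_trans ?_ hlow
  have hdet : ∀ x, (hess v x).det = pd 0 (pd 0 v) x * pd 1 (pd 1 v) x - pd 0 (pd 1 v) x * pd 1 (pd 0 v) x := by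
    intro x; simp [hess, Matrix.det_fin_two]
  simp_rw [hdet]
  rw [green_ball _ _ (c 0) (c 1) r r0]
  have per : PP r π = PP r (-π) := by simp [PP]
  have hiso := isop (-π) π (by linarith [pi_pos]) _ _ _ _ (comp_dt _ (c 0) r) (comp_dt _ (c 1) r)
    (by have := cc; fun_prop) (by have := cc; fun_prop) (by simp [per]) (by simp [per])
  have hs : ∀ t, r * u (PP r t) = √((-(r * sin t) * pd 0 (pd 0 v) (PP r t) + r * cos t * pd 1 (pd 0 v) (PP r t)) ^ 2
      + (-(r * sin t) * pd 0 (pd 1 v) (PP r t) + r * cos t * pd 1 (pd 1 v) (PP r t)) ^ 2) := by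
    intro t
    rw [hform, norm_PP, abs_of_pos r0, Fin.sum_univ_two, pd_symm v hv 1 0]
    nth_rewrite 1 [← Real.sqrt_sq r0.le]
    rw [← Real.sqrt_mul (by positivity)]
    congr 1
    simp [PP]
    field_simp
  simp_rw [hs]
  exact Real.sqrt_le_iff.2 ⟨intervalIntegral.integral_nonneg (by linarith [pi_pos]) fun t _ => Real.sqrt_nonneg _, hiso⟩
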